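/- Let d ≥ 2, a ∈ ℝ^d, b > 0, and let I = [a_1, a_1+2b] × ∏_{i=2}^d [a_i, a_i+b]. Consider the two equivolume partitions of I into two sets: the cube partition Ω_| = (Ω_{1,|}, Ω_{2,|}) with Ω_{1,|} = ∏_{i=1}^d [a_i, a_i+b] and Ω_{2,|} = [a_1+b, a_1+2b] × ∏_{i=2}^d [a_i, a_i+b], and the prism partition Ω_\ = (Ω_{1,\}, Ω_{2,\}) with Ω_{1,\} = conv{(a_1,a_2), (a_1+2b,a_2), (a_1,a_2+b)} × ∏_{i=3}^d [a_i, a_i+b] and Ω_{2,\} = conv{(a_1+2b,a_2), (a_1,a_2+b), (a_1+2b,a_2+b)} × ∏_{i=3}^d [a_i, a_i+b]. Then E L2²(P_{Ω_|}) − E L2²(P_{Ω_\}) = (1/20)·3^{−d} > 0. -/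

import Mathlib

open MeasureTheory ProbabilityTheory

noncomputable section

namespace StratifiedSampling

variable {d : ℕ} {ι : Type} [Fintype ι]

/-- Lebesgue volume of a subset of `ℝ^d` as a real number. -/
def vol (s : Set (Fin d → ℝ)) : ℝ := (volume s).toReal

/-- Number of points of the configuration `p` that lie in the lower box `(-∞, x]`. -/
def countIn (p : ι → (Fin d → ℝ)) (x : Fin d → ℝ) : ℝ :=
  ∑ i, Set.indicator (Set.Iic x) (fun _ => (1 : ℝ)) (p i)

/-- Discrepancy function of the point configuration `p` in the set `K`:
`d_P(x) = #(P ∩ (-∞,x])/N − |K ∩ (-∞,x]|/|K|`. -/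
def discrep (K : Set (Fin d → ℝ)) (p : ι → (Fin d → ℝ)) (x : Fin d → ℝ) : ℝ :=
  countIn p x / (Fintype.card ι : ℝ) - vol (K ∩ Set.Iic x) / vol K

/-- Joint distribution of the stratified sample associated with the family `Ω`:
the points are independent and the `i`-th point is uniformly distributed on `Ω i`. -/
def stratDist (Ω : ι → Set (Fin d → ℝ)) : Measure (ι → (Fin d → ℝ)) :=
  Measure.pi fun i => ProbabilityTheory.cond volume (Ω i)

/-- Mean squared `L2`-discrepancy of the stratified sample from the family `Ω` in `K`:
`E L2²(P_Ω) = E[(1/|K|) ∫_K d_{P_Ω}(x)² dx]`. -/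
def meanL2sq (K : Set (Fin d → ℝ)) (Ω : ι → Set (Fin d → ℝ)) : ℝ :=
  ∫ p, ((1 / vol K) * ∫ x in K, (discrep K p x) ^ 2) ∂(stratDist Ω)

/-- `Ω` is a partition of `K`: measurable sets of positive volume whose union
is `K` and whose distinct members have disjoint interiors. -/
structure IsPartition (K : Set (Fin d → ℝ)) (Ω : ι → Set (Fin d → ℝ)) : Prop where
  measurableSet : ∀ i, MeasurableSet (Ω i)
  vol_pos : ∀ i, 0 < volume (Ω i)
  iUnion_eq : (⋃ i, Ω i) = K
  disjoint_interiors : ∀ i j, i ≠ j → interior (Ω i) ∩ interior (Ω j) = ∅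

/-- All members of `Ω` have the same volume. -/
def IsEquivolume (Ω : ι → Set (Fin d → ℝ)) : Prop :=
  ∀ i j, volume (Ω i) = volume (Ω j)

/-- `q_i(x) = |Ω_i ∩ (-∞,x]| / |Ω_i|`. -/
def qfun (Ω : ι → Set (Fin d → ℝ)) (i : ι) (x : Fin d → ℝ) : ℝ :=
  vol (Ω i ∩ Set.Iic x) / vol (Ω i)

end StratifiedSampling

namespace StratifiedSampling

/-- The box `I = [a₁, a₁+2b] × ∏_{i=2}^d [aᵢ, aᵢ+b]`. -/
def boxI (d : ℕ) (a : Fin d → ℝ) (b : ℝ) : Set (Fin d → ℝ) :=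
  Set.Icc a (fun k => a k + if (k : ℕ) = 0 then 2 * b else b)

/-- The left hypercube `∏_{i=1}^d [aᵢ, aᵢ+b]`. -/
def cubeLeft (d : ℕ) (a : Fin d → ℝ) (b : ℝ) : Set (Fin d → ℝ) :=
  Set.Icc a (fun k => a k + b)

/-- The right hypercube `[a₁+b, a₁+2b] × ∏_{i=2}^d [aᵢ, aᵢ+b]`. -/
def cubeRight (d : ℕ) (a : Fin d → ℝ) (b : ℝ) : Set (Fin d → ℝ) :=
  Set.Icc (fun k => a k + if (k : ℕ) = 0 then b else 0)
    (fun k => a k + if (k : ℕ) = 0 then 2 * b else b)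

/-- The lower triangular hyperprism
`conv{(a₁,a₂), (a₁+2b,a₂), (a₁,a₂+b)} × ∏_{i=3}^d [aᵢ, aᵢ+b]`. -/
def prismLower (d : ℕ) (hd : 2 ≤ d) (a : Fin d → ℝ) (b : ℝ) : Set (Fin d → ℝ) :=
  {x | ![x ⟨0, by omega⟩, x ⟨1, by omega⟩] ∈
      convexHull ℝ {![a ⟨0, by omega⟩, a ⟨1, by omega⟩],
        ![a ⟨0, by omega⟩ + 2 * b, a ⟨1, by omega⟩],
        ![a ⟨0, by omega⟩, a ⟨1, by omega⟩ + b]} ∧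
    ∀ k : Fin d, 2 ≤ (k : ℕ) → (a k ≤ x k ∧ x k ≤ a k + b)}

/-- The upper triangular hyperprism
`conv{(a₁+2b,a₂), (a₁,a₂+b), (a₁+2b,a₂+b)} × ∏_{i=3}^d [aᵢ, aᵢ+b]`. -/
def prismUpper (d : ℕ) (hd : 2 ≤ d) (a : Fin d → ℝ) (b : ℝ) : Set (Fin d → ℝ) :=
  {x | ![x ⟨0, by omega⟩, x ⟨1, by omega⟩] ∈
      convexHull ℝ {![a ⟨0, by omega⟩ + 2 * b, a ⟨1, by omega⟩],
        ![a ⟨0, by omega⟩, a ⟨1, by omega⟩ + b],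
        ![a ⟨0, by omega⟩ + 2 * b, a ⟨1, by omega⟩ + b]} ∧
    ∀ k : Fin d, 2 ≤ (k : ℕ) → (a k ≤ x k ∧ x k ≤ a k + b)}

section Discrepancy

variable {d : ℕ} {ι : Type} [Fintype ι]

lemma countIn_nonneg (p : ι → (Fin d → ℝ)) (x : Fin d → ℝ) : 0 ≤ countIn p x :=
  Finset.sum_nonneg fun _ _ => Set.indicator_nonneg (fun _ _ => zero_le_one) _

lemma countIn_le_card (p : ι → (Fin d → ℝ)) (x : Fin d → ℝ) :
    countIn p x ≤ Fintype.card ι := by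
  have : countIn p x ≤ ∑ _i : ι, (1 : ℝ) :=
    Finset.sum_le_sum fun i _ => Set.indicator_le_self' (fun _ _ => zero_le_one) _
  simpa using this

lemma measurable_countIn :
    Measurable fun z : (ι → (Fin d → ℝ)) × (Fin d → ℝ) => countIn z.1 z.2 := by
  refine Finset.measurable_sum _ fun i _ => ?_
  have hs : MeasurableSet {z : (ι → (Fin d → ℝ)) × (Fin d → ℝ) | z.1 i ≤ z.2} :=
    measurableSet_le (by fun_prop) (by fun_prop)
  exact (measurable_const (a := (1 : ℝ))).indicator hs

lemma measurable_vol_inter_Iic {K : Set (Fin d → ℝ)} (hK : MeasurableSet K) :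
    Measurable fun x : Fin d → ℝ => vol (K ∩ Set.Iic x) := by
  have hs : MeasurableSet {z : (Fin d → ℝ) × (Fin d → ℝ) | z.2 ∈ K ∧ z.2 ≤ z.1} :=
    (measurable_snd hK).inter (measurableSet_le measurable_snd measurable_fst)
  exact (measurable_measure_prodMk_left hs).ennreal_toReal

lemma measurable_discrep {K : Set (Fin d → ℝ)} (hK : MeasurableSet K) :
    Measurable fun z : (ι → (Fin d → ℝ)) × (Fin d → ℝ) => discrep K z.1 z.2 :=
  (measurable_countIn.div_const _).sub
    (((measurable_vol_inter_Iic hK).comp measurable_snd).div_const _)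

lemma abs_discrep_le_one {K : Set (Fin d → ℝ)} (hK : volume K ≠ ⊤) (p : ι → (Fin d → ℝ))
    (x : Fin d → ℝ) : |discrep K p x| ≤ 1 := by
  have h1 : countIn p x / (Fintype.card ι : ℝ) ≤ 1 :=
    div_le_one_of_le₀ (countIn_le_card p x) (by positivity)
  have h2 : 0 ≤ countIn p x / (Fintype.card ι : ℝ) :=
    div_nonneg (countIn_nonneg p x) (by positivity)
  have h3 : vol (K ∩ Set.Iic x) / vol K ≤ 1 :=
    div_le_one_of_le₀ (ENNReal.toReal_mono hK (measure_mono Set.inter_subset_left))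
      ENNReal.toReal_nonneg
  have h4 : 0 ≤ vol (K ∩ Set.Iic x) / vol K :=
    div_nonneg ENNReal.toReal_nonneg ENNReal.toReal_nonneg
  rw [discrep, abs_le]
  constructor <;> linarith

lemma cond_real_Iic {s : Set (Fin d → ℝ)} (hs : MeasurableSet s) (x : Fin d → ℝ) :
    (ProbabilityTheory.cond volume s).real (Set.Iic x) = vol (s ∩ Set.Iic x) / vol s := by
  rw [measureReal_def, ProbabilityTheory.cond_apply hs, ENNReal.toReal_mul, ENNReal.toReal_inv,
    inv_mul_eq_div, vol, vol]

/-- Bias–variance decomposition of the squared discrepancy of a stratified sample at a point. -/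
lemma integral_discrep_sq (K : Set (Fin d → ℝ)) {Ω : ι → Set (Fin d → ℝ)}
    (hΩ : ∀ i, MeasurableSet (Ω i)) (h0 : ∀ i, volume (Ω i) ≠ 0) (ht : ∀ i, volume (Ω i) ≠ ⊤)
    (x : Fin d → ℝ) :
    ∫ p, discrep K p x ^ 2 ∂(stratDist Ω) =
      (∑ i, (qfun Ω i x - qfun Ω i x ^ 2)) / (Fintype.card ι : ℝ) ^ 2 +
        ((∑ i, qfun Ω i x) / Fintype.card ι - vol (K ∩ Set.Iic x) / vol K) ^ 2 := by
  have hprob : ∀ i, IsProbabilityMeasure (ProbabilityTheory.cond volume (Ω i)) := fun i =>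
    ProbabilityTheory.cond_isProbabilityMeasure_of_finite (h0 i) (ht i)
  have hprob' : IsProbabilityMeasure (stratDist Ω) := by unfold stratDist; infer_instance
  have hmem : ∀ i, MemLp (Set.indicator (Set.Iic x) fun _ => (1 : ℝ)) 2
      (ProbabilityTheory.cond volume (Ω i)) := fun i =>
    (memLp_const 1).indicator measurableSet_Iic
  have hexp : ∀ i, ∫ y, Set.indicator (Set.Iic x) (fun _ => (1 : ℝ)) y
      ∂(ProbabilityTheory.cond volume (Ω i)) = qfun Ω i x := fun i => by
    rw [integral_indicator_const _ measurableSet_Iic, cond_real_Iic (hΩ i), qfun, smul_eq_mul,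
      mul_one]
  have hvar : ∀ i, ProbabilityTheory.variance (Set.indicator (Set.Iic x) fun _ => (1 : ℝ))
      (ProbabilityTheory.cond volume (Ω i)) = qfun Ω i x - qfun Ω i x ^ 2 := fun i => by
    rw [ProbabilityTheory.variance_eq_sub (hmem i), hexp i, ← hexp i]
    congr 2
    ext y
    by_cases hy : y ∈ Set.Iic x <;> simp [hy]
  have hcount : ProbabilityTheory.variance (fun p => countIn p x) (stratDist Ω) =
      ∑ i, (qfun Ω i x - qfun Ω i x ^ 2) := by
    simp_rw [← hvar]
    rw [stratDist, ← ProbabilityTheory.variance_sum_pi hmem]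
    congr 1
    ext p
    simp [countIn]
  have hmean : ∫ p, countIn p x ∂(stratDist Ω) = ∑ i, qfun Ω i x := by
    simp_rw [← hexp]
    unfold countIn stratDist
    rw [integral_finsetSum _ fun i _ => integrable_comp_eval ((hmem i).integrable (by norm_num))]
    refine Finset.sum_congr rfl fun i _ => ?_
    exact integral_comp_eval (hmem i).aestronglyMeasurable
  have hmeas : Measurable fun p : ι → (Fin d → ℝ) => countIn p x :=
    measurable_countIn.comp (measurable_id.prodMk measurable_const)
  have hLp : MemLp (fun p : ι → (Fin d → ℝ) => countIn p x) 2 (stratDist Ω) :=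
    MemLp.of_bound hmeas.aestronglyMeasurable (Fintype.card ι) <| ae_of_all _ fun p => by
      rw [Real.norm_of_nonneg (countIn_nonneg p x)]
      exact countIn_le_card p x
  have hLp' : MemLp (fun p : ι → (Fin d → ℝ) => discrep K p x) 2 (stratDist Ω) := by
    unfold discrep
    simp_rw [div_eq_mul_inv (countIn _ _)]
    exact (hLp.mul_const _).sub (memLp_const _)
  have hcountInt := hLp.integrable (by norm_num)
  have key := ProbabilityTheory.variance_eq_sub hLp'
  have hvar' : ProbabilityTheory.variance (fun p => discrep K p x) (stratDist Ω) =
      (∑ i, (qfun Ω i x - qfun Ω i x ^ 2)) / (Fintype.card ι : ℝ) ^ 2 := by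
    unfold discrep
    rw [ProbabilityTheory.variance_sub_const (hmeas.div_const _).aestronglyMeasurable]
    simp_rw [div_eq_mul_inv (countIn _ _)]
    rw [ProbabilityTheory.variance_mul_const, hcount, div_eq_mul_inv, inv_pow]
  have hmean' : ∫ p, discrep K p x ∂(stratDist Ω) =
      (∑ i, qfun Ω i x) / Fintype.card ι - vol (K ∩ Set.Iic x) / vol K := by
    unfold discrep
    rw [integral_sub (hcountInt.div_const _) (integrable_const _), integral_div, hmean]
    simp
  rw [hvar', hmean'] at key
  simp only [Pi.pow_apply] at key
  linarith

/-- The mean squared discrepancy as an iterated integral in the reverse order. -/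
lemma meanL2sq_eq {K : Set (Fin d → ℝ)} {Ω : ι → Set (Fin d → ℝ)} (hK : MeasurableSet K)
    (hKt : volume K ≠ ⊤) (h0 : ∀ i, volume (Ω i) ≠ 0) (ht : ∀ i, volume (Ω i) ≠ ⊤) :
    meanL2sq K Ω = (1 / vol K) * ∫ x in K, ∫ p, discrep K p x ^ 2 ∂(stratDist Ω) := by
  have hprob : ∀ i, IsProbabilityMeasure (ProbabilityTheory.cond volume (Ω i)) := fun i =>
    ProbabilityTheory.cond_isProbabilityMeasure_of_finite (h0 i) (ht i)
  have hprob' : IsProbabilityMeasure (stratDist Ω) := by unfold stratDist; infer_instance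
  have hfin : IsFiniteMeasure (volume.restrict K) := isFiniteMeasure_restrict.2 hKt
  rw [meanL2sq, integral_const_mul, integral_integral_swap]
  refine Integrable.of_bound ((measurable_discrep hK).pow_const 2).aestronglyMeasurable 1 <|
    ae_of_all _ fun z => ?_
  rw [Function.uncurry, Real.norm_eq_abs, abs_pow]
  exact pow_le_one₀ (abs_nonneg _) (abs_discrep_le_one hKt _ _)

end Discrepancy

section Coordinates

variable {n : ℕ}

lemma forall_fin_add_two {P : Fin (n + 2) → Prop} :
    (∀ k, P k) ↔ P 0 ∧ P 1 ∧ ∀ k : Fin n, P k.succ.succ := by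
  rw [Fin.forall_fin_succ, Fin.forall_fin_succ]
  rfl

/-- Coordinates on `ℝ^(n+2)` centred at `a`, separating the first two from the others. -/
def coordEquiv (a : Fin (n + 2) → ℝ) : (ℝ × ℝ) × (Fin n → ℝ) ≃ᵐ (Fin (n + 2) → ℝ) :=
  MeasurableEquiv.prodAssoc.trans <|
    (MeasurableEquiv.prodCongr (MeasurableEquiv.refl ℝ)
      (MeasurableEquiv.piFinSuccAbove (fun _ : Fin (n + 1) => ℝ) 0).symm).trans <|
    (MeasurableEquiv.piFinSuccAbove (fun _ : Fin (n + 2) => ℝ) 0).symm.trans <|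
    MeasurableEquiv.addLeft a

lemma measurePreserving_coordEquiv (a : Fin (n + 2) → ℝ) :
    MeasurePreserving (coordEquiv a) volume volume :=
  (((measurePreserving_add_left volume a).comp
    (volume_preserving_piFinSuccAbove (fun _ : Fin (n + 2) => ℝ) 0).symm).comp
    ((MeasurePreserving.id volume).prod
      (volume_preserving_piFinSuccAbove (fun _ : Fin (n + 1) => ℝ) 0).symm)).comp
    volume_preserving_prodAssoc

@[simp] lemma coordEquiv_zero (a : Fin (n + 2) → ℝ) (z : ℝ × ℝ) (r : Fin n → ℝ) :
    coordEquiv a (z, r) 0 = a 0 + z.1 := rfl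

@[simp] lemma coordEquiv_one (a : Fin (n + 2) → ℝ) (z : ℝ × ℝ) (r : Fin n → ℝ) :
    coordEquiv a (z, r) 1 = a 1 + z.2 := rfl

@[simp] lemma coordEquiv_succ_succ (a : Fin (n + 2) → ℝ) (z : ℝ × ℝ) (r : Fin n → ℝ)
    (k : Fin n) : coordEquiv a (z, r) k.succ.succ = a k.succ.succ + r k := rfl

/-- The rectangle `[0, 2b] × [0, b]`. -/
def planeBox (b : ℝ) : Set (ℝ × ℝ) := Set.Icc 0 (2 * b) ×ˢ Set.Icc 0 b

/-- The cube `[0, b]^n`. -/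
def fiberBox (n : ℕ) (b : ℝ) : Set (Fin n → ℝ) := Set.univ.pi fun _ => Set.Icc 0 b

lemma preimage_boxI (a : Fin (n + 2) → ℝ) (b : ℝ) :
    coordEquiv a ⁻¹' boxI (n + 2) a b = planeBox b ×ˢ fiberBox n b := by
  ext ⟨z, r⟩
  simp only [boxI, planeBox, fiberBox, Set.mem_preimage, Set.mem_Icc, Pi.le_def,
    forall_fin_add_two, Set.mem_prod, Set.mem_univ_pi, forall_and]
  simp
  tauto

lemma vol_eq_of_preimage {a : Fin (n + 2) → ℝ} {S : Set (Fin (n + 2) → ℝ)} {T : Set (ℝ × ℝ)}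
    {r : Fin n → ℝ} (hr : 0 ≤ r) (h : coordEquiv a ⁻¹' S = T ×ˢ Set.Icc 0 r) :
    vol S = volume.real T * ∏ k, r k := by
  rw [vol, ← (measurePreserving_coordEquiv a).measure_preimage_equiv, h, Measure.volume_eq_prod,
    Measure.prod_prod, ENNReal.toReal_mul, measureReal_def, Real.volume_Icc_pi_toReal hr]
  simp

lemma setIntegral_fiberBox_prod (g : ℝ → ℝ) {b : ℝ} (hb : 0 ≤ b) :
    ∫ r in fiberBox n b, ∏ k, g (r k) = (∫ t in (0)..b, g t) ^ n := by
  rw [fiberBox, volume_pi, Measure.restrict_pi_pi, integral_fintype_prod_eq_pow, Fintype.card_fin,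
    intervalIntegral.integral_of_le hb, integral_Icc_eq_integral_Ioc]

lemma setIntegral_boxI (a : Fin (n + 2) → ℝ) {b : ℝ} (hb : 0 ≤ b) (F : (Fin (n + 2) → ℝ) → ℝ)
    (G : ℝ × ℝ → ℝ) (g : ℝ → ℝ)
    (h : ∀ z ∈ planeBox b, ∀ r ∈ fiberBox n b, F (coordEquiv a (z, r)) = G z * ∏ k, g (r k)) :
    ∫ x in boxI (n + 2) a b, F x = (∫ z in planeBox b, G z) * (∫ t in (0)..b, g t) ^ n := by
  have hm : MeasurableSet (planeBox b ×ˢ fiberBox n b) :=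
    (measurableSet_Icc.prod measurableSet_Icc).prod
      (MeasurableSet.univ_pi fun _ => measurableSet_Icc)
  rw [← (measurePreserving_coordEquiv a).setIntegral_preimage_emb
    (coordEquiv a).measurableEmbedding, preimage_boxI,
    setIntegral_congr_fun hm (fun z hz => h z.1 hz.1 z.2 hz.2), ← setIntegral_fiberBox_prod g hb,
    Measure.volume_eq_prod]
  exact setIntegral_prod_mul G (fun r : Fin n → ℝ => ∏ k, g (r k)) _ _

lemma setIntegral_planeBox {G : ℝ × ℝ → ℝ} (hG : Continuous G) {b : ℝ} (hb : 0 ≤ b) :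
    ∫ z in planeBox b, G z = ∫ s in (0)..(2 * b), ∫ t in (0)..b, G (s, t) := by
  rw [planeBox, Measure.volume_eq_prod, setIntegral_prod,
    intervalIntegral.integral_of_le (by positivity), integral_Icc_eq_integral_Ioc]
  · simp_rw [intervalIntegral.integral_of_le hb, integral_Icc_eq_integral_Ioc]
  · rw [← Measure.volume_eq_prod]
    exact hG.continuousOn.integrableOn_compact (isCompact_Icc.prod isCompact_Icc)

end Coordinates

section Plane

lemma volume_real_between {g h : ℝ → ℝ} (hg : Continuous g) (hh : Continuous h) {X : ℝ}
    (hX : 0 ≤ X) :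
    volume.real {z : ℝ × ℝ | z.1 ∈ Set.Icc 0 X ∧ z.2 ∈ Set.Icc (g z.1) (h z.1)} =
      ∫ s in (0)..X, max (h s - g s) 0 := by
  have hm : MeasurableSet {z : ℝ × ℝ | z.1 ∈ Set.Icc 0 X ∧ z.2 ∈ Set.Icc (g z.1) (h z.1)} :=
    (measurable_fst measurableSet_Icc).inter
      ((measurableSet_le (by fun_prop) measurable_snd).inter
        (measurableSet_le measurable_snd (by fun_prop)))
  rw [intervalIntegral.integral_of_le hX, ← integral_Icc_eq_integral_Ioc,
    integral_eq_lintegral_of_nonneg_ae (f := fun s => max (h s - g s) 0)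
      (ae_of_all _ fun _ => le_max_right _ _)
      (by fun_prop : Continuous fun s => max (h s - g s) 0).aestronglyMeasurable,
    measureReal_def, Measure.volume_eq_prod, Measure.prod_apply hm,
    ← lintegral_indicator measurableSet_Icc]
  congr 2
  ext s
  by_cases hs : s ∈ Set.Icc 0 X
  · have : Prod.mk s ⁻¹' {z : ℝ × ℝ | z.1 ∈ Set.Icc 0 X ∧ z.2 ∈ Set.Icc (g z.1) (h z.1)} =
        Set.Icc (g s) (h s) := by
      ext t
      exact and_iff_right hs
    rw [this, Set.indicator_of_mem hs, Real.volume_Icc, ENNReal.ofReal_max]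
    simp
  · have : Prod.mk s ⁻¹' {z : ℝ × ℝ | z.1 ∈ Set.Icc 0 X ∧ z.2 ∈ Set.Icc (g z.1) (h z.1)} =
        ∅ := by
      ext t
      exact iff_of_false (fun ht => hs ht.1) (Set.notMem_empty _)
    rw [this, Set.indicator_of_notMem hs, measure_empty]

lemma hasDerivAt_max_zero_pow (k : ℕ) (x : ℝ) :
    HasDerivAt (fun y : ℝ => max y 0 ^ (k + 2)) ((k + 2 : ℕ) * max x 0 ^ (k + 1)) x := by
  rcases lt_trichotomy x 0 with hx | rfl | hx
  · rw [max_eq_right hx.le, zero_pow k.succ_ne_zero, mul_zero]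
    refine (hasDerivAt_const x (0 : ℝ)).congr_of_eventuallyEq ?_
    filter_upwards [Iio_mem_nhds hx] with y hy
    rw [max_eq_right (le_of_lt hy), zero_pow (by omega)]
  · have h1 : HasDerivWithinAt (fun y : ℝ => max y 0 ^ (k + 2)) 0 (Set.Iic 0) 0 := by
      refine (hasDerivWithinAt_const (0 : ℝ) _ (0 : ℝ)).congr (fun y hy => ?_) (by simp)
      rw [max_eq_right hy, zero_pow (by omega)]
    have h2 : HasDerivWithinAt (fun y : ℝ => max y 0 ^ (k + 2)) 0 (Set.Ici 0) 0 := by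
      refine ((hasDerivAt_pow (k + 2) (0 : ℝ)).congr_deriv (by simp)).hasDerivWithinAt.congr
        (fun y hy => ?_) (by simp)
      rw [max_eq_left hy]
    have h3 := h1.union h2
    rw [Set.Iic_union_Ici, hasDerivWithinAt_univ] at h3
    simpa using h3
  · rw [max_eq_left hx.le]
    refine (hasDerivAt_pow (k + 2) x).congr_of_eventuallyEq ?_
    filter_upwards [Ioi_mem_nhds hx] with y hy
    rw [max_eq_left (le_of_lt hy)]

/-- The positive part of `s/2 + t - b`. -/
def excess (b s t : ℝ) : ℝ := max (s / 2 + t - b) 0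

lemma continuous_excess (b : ℝ) : Continuous fun z : ℝ × ℝ => excess b z.1 z.2 := by
  unfold excess
  fun_prop

lemma hasDerivAt_excess_pow_left (b t : ℝ) (k : ℕ) (s : ℝ) :
    HasDerivAt (fun s => excess b s t ^ (k + 2))
      ((k + 2 : ℕ) * excess b s t ^ (k + 1) * (1 / 2)) s := by
  have h : HasDerivAt (fun s : ℝ => s / 2 + t - b) (1 / 2) s := by
    simpa using (((hasDerivAt_id s).div_const 2).add_const t).sub_const b
  exact (hasDerivAt_max_zero_pow k _).comp s h

lemma hasDerivAt_excess_pow_right (b s : ℝ) (k : ℕ) (t : ℝ) :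
    HasDerivAt (fun t => excess b s t ^ (k + 2))
      ((k + 2 : ℕ) * excess b s t ^ (k + 1)) t := by
  have h : HasDerivAt (fun t : ℝ => s / 2 + t - b) 1 t := by
    simpa using ((hasDerivAt_id t).const_add (s / 2)).sub_const b
  exact ((hasDerivAt_max_zero_pow k _).comp t h).congr_deriv (mul_one _)

lemma excess_of_le {b s t : ℝ} (h : s / 2 + t ≤ b) : excess b s t = 0 :=
  max_eq_right (by linarith)

/-- The lower triangle of the rectangle `[0, 2b] × [0, b]`. -/
def lowerTriangle (b : ℝ) : Set (ℝ × ℝ) := {z | 0 ≤ z.1 ∧ 0 ≤ z.2 ∧ z.1 / 2 + z.2 ≤ b}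

/-- The upper triangle of the rectangle `[0, 2b] × [0, b]`. -/
def upperTriangle (b : ℝ) : Set (ℝ × ℝ) := {z | z.1 ≤ 2 * b ∧ z.2 ≤ b ∧ b ≤ z.1 / 2 + z.2}

lemma measurableSet_lowerTriangle (b : ℝ) : MeasurableSet (lowerTriangle b) :=
  (measurableSet_le measurable_const measurable_fst).inter
    ((measurableSet_le measurable_const measurable_snd).inter
      (measurableSet_le ((measurable_fst.div_const 2).add measurable_snd) measurable_const))

lemma measurableSet_upperTriangle (b : ℝ) : MeasurableSet (upperTriangle b) :=
  (measurableSet_le measurable_fst measurable_const).inter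
    ((measurableSet_le measurable_snd measurable_const).inter
      (measurableSet_le measurable_const ((measurable_fst.div_const 2).add measurable_snd)))

lemma volume_real_upperTriangle_inter_Iic {b : ℝ} {z : ℝ × ℝ} (hz : z ∈ planeBox b) :
    volume.real (upperTriangle b ∩ Set.Iic z) = excess b z.1 z.2 ^ 2 := by
  obtain ⟨⟨h1, h2⟩, h3, h4⟩ := hz
  have hset : upperTriangle b ∩ Set.Iic z =
      {w : ℝ × ℝ | w.1 ∈ Set.Icc 0 z.1 ∧ w.2 ∈ Set.Icc (b - w.1 / 2) z.2} := by
    ext w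
    simp only [upperTriangle, Set.mem_inter_iff, Set.mem_ofPred_eq, Set.mem_Iic, Prod.le_def,
      Set.mem_Icc]
    constructor
    · rintro ⟨⟨h5, h6, h7⟩, h8, h9⟩
      exact ⟨⟨by linarith, h8⟩, by linarith, h9⟩
    · rintro ⟨⟨h5, h6⟩, h7, h8⟩
      exact ⟨⟨by linarith, by linarith, by linarith⟩, h6, h8⟩
  rw [hset, volume_real_between (g := fun s => b - s / 2) (h := fun _ => z.2) (by fun_prop)
    (by fun_prop) h1, intervalIntegral.integral_eq_sub_of_hasDerivAt
      (f := fun s => excess b s z.2 ^ 2) (fun s _ => ?_)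
      (Continuous.intervalIntegrable (by fun_prop) _ _)]
  · rw [excess_of_le (s := 0) (by linarith)]
    ring
  · refine (hasDerivAt_excess_pow_left b z.2 0 s).congr_deriv ?_
    rw [excess, show z.2 - (b - s / 2) = s / 2 + z.2 - b by ring]
    push_cast
    ring

lemma volume_real_lowerTriangle_inter_Iic {b : ℝ} {z : ℝ × ℝ} (hz : z ∈ planeBox b) :
    volume.real (lowerTriangle b ∩ Set.Iic z) = z.1 * z.2 - excess b z.1 z.2 ^ 2 := by
  obtain ⟨⟨h1, h2⟩, h3, h4⟩ := hz
  have hset : lowerTriangle b ∩ Set.Iic z =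
      {w : ℝ × ℝ | w.1 ∈ Set.Icc 0 z.1 ∧ w.2 ∈ Set.Icc 0 (min z.2 (b - w.1 / 2))} := by
    ext w
    simp only [lowerTriangle, Set.mem_inter_iff, Set.mem_ofPred_eq, Set.mem_Iic, Prod.le_def,
      Set.mem_Icc, le_min_iff]
    constructor
    · rintro ⟨⟨h5, h6, h7⟩, h8, h9⟩
      exact ⟨⟨h5, h8⟩, h6, h9, by linarith⟩
    · rintro ⟨⟨h5, h6⟩, h7, h8, h9⟩
      exact ⟨⟨h5, h7, by linarith⟩, h6, h8⟩
  rw [hset, volume_real_between (g := fun _ => 0) (h := fun s => min z.2 (b - s / 2))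
    (by fun_prop) (by fun_prop) h1, intervalIntegral.integral_eq_sub_of_hasDerivAt
      (f := fun s => s * z.2 - excess b s z.2 ^ 2) (fun s hs => ?_)
      (Continuous.intervalIntegrable (by fun_prop) _ _)]
  · rw [excess_of_le (s := 0) (by linarith)]
    ring
  · rw [Set.uIcc_of_le h1, Set.mem_Icc] at hs
    refine (((hasDerivAt_id s).mul_const z.2).sub
      (hasDerivAt_excess_pow_left b z.2 0 s)).congr_deriv ?_
    rw [sub_zero, max_eq_left (le_min h3 (by linarith)), excess]
    push_cast
    rcases le_total z.2 (b - s / 2) with h | h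
    · rw [min_eq_left h, max_eq_right (by linarith)]
      ring
    · rw [min_eq_right h, max_eq_left (by linarith)]
      ring

lemma Icc_inter_Iic_eq {α : Type*} [Lattice α] (s t u : α) :
    Set.Icc s t ∩ Set.Iic u = Set.Icc s (t ⊓ u) := by
  ext v
  simp [and_assoc]

lemma volume_real_Icc_prod_Icc {s₁ s₂ t₁ t₂ : ℝ} :
    volume.real (Set.Icc s₁ s₂ ×ˢ Set.Icc t₁ t₂) = max (s₂ - s₁) 0 * max (t₂ - t₁) 0 := by
  rw [measureReal_def, Measure.volume_eq_prod, Measure.prod_prod, ENNReal.toReal_mul,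
    ← measureReal_def, ← measureReal_def, Real.volume_real_Icc, Real.volume_real_Icc]

lemma volume_real_left_square_inter_Iic {b : ℝ} (hb : 0 ≤ b) {z : ℝ × ℝ} (hz : z ∈ planeBox b) :
    volume.real (Set.Icc 0 b ×ˢ Set.Icc 0 b ∩ Set.Iic z) =
      (z.1 - max (z.1 - b) 0) * z.2 := by
  obtain ⟨⟨h1, h2⟩, h3, h4⟩ := hz
  rw [← Set.Iic_prod_Iic, Set.prod_inter_prod, Icc_inter_Iic_eq, Icc_inter_Iic_eq,
    volume_real_Icc_prod_Icc, min_eq_right h4, sub_zero, sub_zero, max_eq_left h3]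
  rcases le_total z.1 b with h | h
  · rw [min_eq_right h, max_eq_left h1, max_eq_right (by linarith), sub_zero]
  · rw [min_eq_left h, max_eq_left hb, max_eq_left (by linarith), sub_sub_cancel]

lemma volume_real_right_square_inter_Iic {b : ℝ} {z : ℝ × ℝ} (hz : z ∈ planeBox b) :
    volume.real (Set.Icc b (2 * b) ×ˢ Set.Icc 0 b ∩ Set.Iic z) = max (z.1 - b) 0 * z.2 := by
  obtain ⟨⟨h1, h2⟩, h3, h4⟩ := hz
  rw [← Set.Iic_prod_Iic, Set.prod_inter_prod, Icc_inter_Iic_eq, Icc_inter_Iic_eq,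
    volume_real_Icc_prod_Icc, min_eq_right h4, min_eq_right h2, sub_zero, max_eq_left h3]

lemma integral_prism_profile {b : ℝ} (hb : 0 ≤ b) :
    ∫ s in (0)..(2 * b), ∫ t in (0)..b,
      ((s * t - excess b s t ^ 2) ^ 2 + (excess b s t ^ 2) ^ 2) = 3 / 5 * b ^ 6 := by
  have hinner : ∀ s ∈ Set.uIcc 0 (2 * b), ∫ t in (0)..b,
      ((s * t - excess b s t ^ 2) ^ 2 + (excess b s t ^ 2) ^ 2) =
        s ^ 2 * b ^ 3 / 3 - b * s ^ 4 / 12 + 11 * s ^ 5 / 480 := by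
    intro s hs
    rw [Set.uIcc_of_le (by positivity), Set.mem_Icc] at hs
    rw [intervalIntegral.integral_eq_sub_of_hasDerivAt
      (f := fun t => s ^ 2 / 3 * t ^ 3 - 2 * s * (t / 3 * excess b s t ^ 3
        - excess b s t ^ 4 / 12) + 2 / 5 * excess b s t ^ 5) (fun t _ => ?_)
      (Continuous.intervalIntegrable (by unfold excess; fun_prop) _ _)]
    · rw [excess_of_le (t := 0) (by linarith), excess, max_eq_left (by linarith)]
      ring
    · have h3 := hasDerivAt_excess_pow_right b s 1 t
      have h4 := hasDerivAt_excess_pow_right b s 2 t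
      have h5 := hasDerivAt_excess_pow_right b s 3 t
      refine ((((hasDerivAt_pow 3 t).const_mul (s ^ 2 / 3)).sub
        (((((hasDerivAt_id t).div_const 3).mul h3).sub (h4.div_const 12)).const_mul
          (2 * s))).add (h5.const_mul (2 / 5))).congr_deriv ?_
      simp only [id]
      push_cast
      ring
  rw [intervalIntegral.integral_congr hinner, intervalIntegral.integral_eq_sub_of_hasDerivAt
    (f := fun s => s ^ 3 * b ^ 3 / 9 - b * s ^ 5 / 60 + 11 * s ^ 6 / 2880) (fun s _ => ?_)
    (Continuous.intervalIntegrable (by fun_prop) _ _)]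
  · ring
  · refine ((((hasDerivAt_pow 3 s).mul_const (b ^ 3)).div_const 9).sub
      (((hasDerivAt_pow 5 s).const_mul b).div_const 60)).add
        (((hasDerivAt_pow 6 s).const_mul 11).div_const 2880) |>.congr_deriv ?_
    push_cast
    ring

lemma integral_cube_profile {b : ℝ} (hb : 0 ≤ b) :
    ∫ s in (0)..(2 * b), ∫ t in (0)..b,
      (((s - max (s - b) 0) * t) ^ 2 + (max (s - b) 0 * t) ^ 2) = 5 / 9 * b ^ 6 := by
  have hinner : ∀ s, ∫ t in (0)..b,
      (((s - max (s - b) 0) * t) ^ 2 + (max (s - b) 0 * t) ^ 2) =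
        (s ^ 2 - 2 * b * max (s - b) 0) * (b ^ 3 / 3) := by
    intro s
    have hpoly : ∀ t, ((s - max (s - b) 0) * t) ^ 2 + (max (s - b) 0 * t) ^ 2 =
        (s ^ 2 - 2 * b * max (s - b) 0) * t ^ 2 := by
      intro t
      rcases le_total s b with h | h
      · rw [max_eq_right (by linarith)]
        ring
      · rw [max_eq_left (by linarith)]
        ring
    simp_rw [hpoly]
    rw [intervalIntegral.integral_const_mul, integral_pow]
    norm_num
  simp_rw [hinner]
  rw [intervalIntegral.integral_mul_const, intervalIntegral.integral_eq_sub_of_hasDerivAt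
    (f := fun s => s ^ 3 / 3 - b * max (s - b) 0 ^ 2) (fun s _ => ?_)
    (Continuous.intervalIntegrable (by fun_prop) _ _)]
  · rw [max_eq_left (by linarith), max_eq_right (by linarith)]
    ring
  · have h := (hasDerivAt_max_zero_pow 0 (s - b)).comp s ((hasDerivAt_id s).sub_const b)
    refine (((hasDerivAt_pow 3 s).div_const 3).sub (h.const_mul b)).congr_deriv ?_
    push_cast
    ring

end Plane

section Cylinders

variable {n : ℕ}

lemma fiberBox_eq_Icc (n : ℕ) (b : ℝ) : fiberBox n b = Set.Icc 0 fun _ => b :=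
  Set.pi_univ_Icc 0 fun _ => b

lemma preimage_inter_Iic {a : Fin (n + 2) → ℝ} {b : ℝ} {S : Set (Fin (n + 2) → ℝ)}
    {T : Set (ℝ × ℝ)} (h : coordEquiv a ⁻¹' S = T ×ˢ fiberBox n b) (z : ℝ × ℝ) {r : Fin n → ℝ}
    (hr : r ∈ fiberBox n b) :
    coordEquiv a ⁻¹' (S ∩ Set.Iic (coordEquiv a (z, r))) = (T ∩ Set.Iic z) ×ˢ Set.Icc 0 r := by
  rw [fiberBox_eq_Icc] at h hr
  rw [Set.preimage_inter, h]
  ext ⟨w, q⟩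
  have hle : coordEquiv a (w, q) ≤ coordEquiv a (z, r) ↔ w ≤ z ∧ q ≤ r := by
    simp only [Pi.le_def, forall_fin_add_two, Prod.le_def]
    simp [and_assoc]
  simp only [Set.mem_inter_iff, Set.mem_prod, Set.mem_preimage, Set.mem_Iic, hle, Set.mem_Icc]
  constructor
  · rintro ⟨⟨h1, h2, h3⟩, h4, h5⟩
    exact ⟨⟨h1, h4⟩, h2, h5⟩
  · rintro ⟨⟨h1, h2⟩, h3, h4⟩
    exact ⟨⟨h1, h3, h4.trans hr.2⟩, h2, h4⟩

lemma vol_inter_Iic {a : Fin (n + 2) → ℝ} {b : ℝ} {S : Set (Fin (n + 2) → ℝ)}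
    {T : Set (ℝ × ℝ)} (h : coordEquiv a ⁻¹' S = T ×ˢ fiberBox n b) (z : ℝ × ℝ) {r : Fin n → ℝ}
    (hr : r ∈ fiberBox n b) :
    vol (S ∩ Set.Iic (coordEquiv a (z, r))) = volume.real (T ∩ Set.Iic z) * ∏ k, r k :=
  vol_eq_of_preimage (fun k => (hr k trivial).1) (preimage_inter_Iic h z hr)

lemma planeBox_subset_Iic (b : ℝ) : planeBox b ⊆ Set.Iic (2 * b, b) :=
  fun _ hz => ⟨hz.1.2, hz.2.2⟩

lemma vol_of_cylinder {a : Fin (n + 2) → ℝ} {b : ℝ} (hb : 0 ≤ b) {S : Set (Fin (n + 2) → ℝ)}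
    {T : Set (ℝ × ℝ)} (h : coordEquiv a ⁻¹' S = T ×ˢ fiberBox n b) (hT : T ⊆ planeBox b) :
    vol S = volume.real (T ∩ Set.Iic (2 * b, b)) * b ^ n := by
  rw [Set.inter_eq_left.2 (hT.trans (planeBox_subset_Iic b)),
    vol_eq_of_preimage (fun _ => hb) (h.trans (by rw [fiberBox_eq_Icc]))]
  simp

lemma corner_mem_planeBox {b : ℝ} (hb : 0 ≤ b) : (2 * b, b) ∈ planeBox b :=
  ⟨⟨by positivity, le_rfl⟩, hb, le_rfl⟩

lemma volume_real_planeBox_inter_Iic {b : ℝ} {z : ℝ × ℝ} (hz : z ∈ planeBox b) :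
    volume.real (planeBox b ∩ Set.Iic z) = z.1 * z.2 := by
  obtain ⟨⟨h1, h2⟩, h3, h4⟩ := hz
  rw [planeBox, ← Set.Iic_prod_Iic, Set.prod_inter_prod, Icc_inter_Iic_eq, Icc_inter_Iic_eq,
    volume_real_Icc_prod_Icc, min_eq_right h4, min_eq_right h2, sub_zero, sub_zero,
    max_eq_left h3, max_eq_left h1]

/-- Mean squared discrepancy of an equivolume stratification of the box into two cylinders over
subsets of the rectangle `[0, 2b] × [0, b]`, in terms of the area functions of their bases. -/
lemma meanL2sq_of_cylinders {a : Fin (n + 2) → ℝ} {b : ℝ} (hb : 0 < b)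
    {Ω : Fin 2 → Set (Fin (n + 2) → ℝ)} {T : Fin 2 → Set (ℝ × ℝ)} {f : Fin 2 → ℝ × ℝ → ℝ}
    (hΩ : ∀ i, coordEquiv a ⁻¹' Ω i = T i ×ˢ fiberBox n b) (hT : ∀ i, T i ⊆ planeBox b)
    (hTm : ∀ i, MeasurableSet (T i)) (hf : ∀ i, Continuous (f i))
    (hfT : ∀ i, ∀ z ∈ planeBox b, volume.real (T i ∩ Set.Iic z) = f i z)
    (hcorner : ∀ i, f i (2 * b, b) = b ^ 2) (hsum : ∀ z, f 0 z + f 1 z = z.1 * z.2) {J : ℝ}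
    (hJ : ∫ s in (0)..(2 * b), ∫ t in (0)..b, (f 0 (s, t) ^ 2 + f 1 (s, t) ^ 2) = J) :
    meanL2sq (boxI (n + 2) a b) Ω =
      1 / (8 * b ^ (n + 2)) *
        ((∫ z in planeBox b, z.1 * z.2) / b ^ (n + 2) * (∫ t in (0)..b, t) ^ n -
          J / (b ^ (n + 2)) ^ 2 * (b ^ 3 / 3) ^ n) := by
  have hB : 0 < b ^ (n + 2) := by positivity
  have hvol : ∀ i, vol (Ω i) = b ^ (n + 2) := fun i => by
    rw [vol_of_cylinder hb.le (hΩ i) (hT i), hfT i _ (corner_mem_planeBox hb.le), hcorner i]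
    ring
  have hbox := preimage_boxI a b
  have hvolK : vol (boxI (n + 2) a b) = 2 * b ^ (n + 2) := by
    rw [vol_of_cylinder hb.le hbox subset_rfl,
      volume_real_planeBox_inter_Iic (corner_mem_planeBox hb.le)]
    ring
  have hpos : ∀ i, 0 < volume (Ω i) ∧ volume (Ω i) < ⊤ := fun i =>
    ENNReal.toReal_pos_iff.1 (by rw [← vol, hvol i]; exact hB)
  have hΩm : ∀ i, MeasurableSet (Ω i) := fun i => by
    rw [← (coordEquiv a).measurableSet_preimage, hΩ i]
    exact (hTm i).prod (MeasurableSet.univ_pi fun _ => measurableSet_Icc)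
  have hKcomp : IsCompact (boxI (n + 2) a b) := isCompact_Icc
  rw [meanL2sq_eq hKcomp.measurableSet hKcomp.measure_lt_top.ne (fun i => (hpos i).1.ne')
    (fun i => (hpos i).2.ne), hvolK]
  simp_rw [integral_discrep_sq _ hΩm (fun i => (hpos i).1.ne') (fun i => (hpos i).2.ne)]
  set A : (Fin (n + 2) → ℝ) → ℝ := fun x =>
    (x 0 - a 0) * (x 1 - a 1) / b ^ (n + 2) * ∏ k : Fin n, (x k.succ.succ - a k.succ.succ)
    with hA
  set C : (Fin (n + 2) → ℝ) → ℝ := fun x =>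
    (f 0 (x 0 - a 0, x 1 - a 1) ^ 2 + f 1 (x 0 - a 0, x 1 - a 1) ^ 2) / (b ^ (n + 2)) ^ 2 *
      ∏ k : Fin n, (x k.succ.succ - a k.succ.succ) ^ 2 with hC
  have hAc : Continuous A := by fun_prop
  have hCc : Continuous C := by
    have h0 := hf 0
    have h1 := hf 1
    fun_prop
  have hAint : ∫ x in boxI (n + 2) a b, A x =
      (∫ z in planeBox b, z.1 * z.2) / b ^ (n + 2) * (∫ t in (0)..b, t) ^ n := by
    rw [← integral_div]
    exact setIntegral_boxI a hb.le A _ (fun t => t) fun z _ r _ => by simp [hA]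
  have hCint : ∫ x in boxI (n + 2) a b, C x =
      J / (b ^ (n + 2)) ^ 2 * (b ^ 3 / 3) ^ n := by
    have hsq : ∫ t in (0)..b, t ^ 2 = b ^ 3 / 3 := by
      rw [integral_pow]
      norm_num
    rw [← hJ, ← setIntegral_planeBox (G := fun z => f 0 z ^ 2 + f 1 z ^ 2)
      (((hf 0).pow 2).add ((hf 1).pow 2)) hb.le, ← integral_div, ← hsq]
    exact setIntegral_boxI a hb.le C _ (fun t => t ^ 2) fun z _ r _ => by simp [hC]
  rw [← hAint, ← hCint, ← integral_sub
    (hAc.continuousOn.integrableOn_compact hKcomp) (hCc.continuousOn.integrableOn_compact hKcomp),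
    ← integral_const_mul, ← integral_const_mul]
  refine setIntegral_congr_fun measurableSet_Icc fun x hx => ?_
  obtain ⟨⟨z, r⟩, rfl⟩ := (coordEquiv a).surjective x
  have hzr : (z, r) ∈ planeBox b ×ˢ fiberBox n b := by
    rw [← hbox]
    exact hx
  have hq : ∀ i, qfun Ω i (coordEquiv a (z, r)) = f i z * (∏ k, r k) / b ^ (n + 2) := fun i => by
    rw [qfun, vol_inter_Iic (hΩ i) z hzr.2, hvol i, hfT i z hzr.1]
  have hz : f 1 z = z.1 * z.2 - f 0 z := by linarith [hsum z]
  simp only [hq, hvolK, vol_inter_Iic hbox z hzr.2, volume_real_planeBox_inter_Iic hzr.1, hA, hC,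
    Fin.sum_univ_two, Fintype.card_fin, coordEquiv_zero, coordEquiv_one, coordEquiv_succ_succ,
    add_sub_cancel_left, Finset.prod_pow, hz]
  field_simp
  ring

lemma preimage_cubeLeft (a : Fin (n + 2) → ℝ) (b : ℝ) :
    coordEquiv a ⁻¹' cubeLeft (n + 2) a b =
      (Set.Icc 0 b ×ˢ Set.Icc 0 b) ×ˢ fiberBox n b := by
  ext ⟨z, r⟩
  simp only [cubeLeft, fiberBox, Set.mem_preimage, Set.mem_Icc, Pi.le_def,
    forall_fin_add_two, Set.mem_prod, Set.mem_univ_pi, forall_and]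
  simp
  tauto

lemma preimage_cubeRight (a : Fin (n + 2) → ℝ) (b : ℝ) :
    coordEquiv a ⁻¹' cubeRight (n + 2) a b =
      (Set.Icc b (2 * b) ×ˢ Set.Icc 0 b) ×ˢ fiberBox n b := by
  ext ⟨z, r⟩
  simp only [cubeRight, fiberBox, Set.mem_preimage, Set.mem_Icc, Pi.le_def,
    forall_fin_add_two, Set.mem_prod, Set.mem_univ_pi, forall_and]
  simp
  tauto

lemma mem_convexHull_lowerTriangle {b : ℝ} (hb : 0 < b) (p q : ℝ) (z : ℝ × ℝ) :
    ![p + z.1, q + z.2] ∈ convexHull ℝ {![p, q], ![p + 2 * b, q], ![p, q + b]} ↔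
      z ∈ lowerTriangle b := by
  constructor
  · intro h
    have hsub : convexHull ℝ {![p, q], ![p + 2 * b, q], ![p, q + b]} ⊆
        {v : Fin 2 → ℝ | 0 ≤ v 0 - p ∧ 0 ≤ v 1 - q ∧ (v 0 - p) / 2 + (v 1 - q) ≤ b} := by
      refine convexHull_min ?_ ?_
      · rintro v (rfl | rfl | rfl) <;> simp [hb.le]
      · rintro v ⟨h1, h2, h3⟩ w ⟨h4, h5, h6⟩ α β hα hβ hαβ
        obtain rfl : β = 1 - α := by linarith
        simp only [Set.mem_ofPred_eq, Pi.add_apply, Pi.smul_apply, smul_eq_mul]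
        refine ⟨?_, ?_, ?_⟩ <;> nlinarith
    simpa [lowerTriangle] using hsub h
  · rintro ⟨h1, h2, h3⟩
    refine mem_convexHull_of_exists_fintype (ι := Fin 3)
      ![1 - z.1 / (2 * b) - z.2 / b, z.1 / (2 * b), z.2 / b]
      ![![p, q], ![p + 2 * b, q], ![p, q + b]] ?_ ?_ ?_ ?_
    · have h4 : 0 ≤ 1 - z.1 / (2 * b) - z.2 / b := by
        rw [show 1 - z.1 / (2 * b) - z.2 / b = (b - (z.1 / 2 + z.2)) / b by field_simp; ring]
        exact div_nonneg (by linarith) hb.le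
      have h5 : 0 ≤ z.1 / (2 * b) := by positivity
      have h6 : 0 ≤ z.2 / b := by positivity
      intro i
      fin_cases i <;> assumption
    · simp only [Fin.sum_univ_three, Matrix.cons_val]
      ring
    · intro i
      fin_cases i <;> simp
    · ext i
      fin_cases i <;> simp [Fin.sum_univ_three] <;> field_simp <;> ring

lemma mem_convexHull_upperTriangle {b : ℝ} (hb : 0 < b) (p q : ℝ) (z : ℝ × ℝ) :
    ![p + z.1, q + z.2] ∈
        convexHull ℝ {![p + 2 * b, q], ![p, q + b], ![p + 2 * b, q + b]} ↔
      z ∈ upperTriangle b := by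
  constructor
  · intro h
    have hsub : convexHull ℝ {![p + 2 * b, q], ![p, q + b], ![p + 2 * b, q + b]} ⊆
        {v : Fin 2 → ℝ | v 0 ≤ p + 2 * b ∧ v 1 ≤ q + b ∧ b ≤ (v 0 - p) / 2 + (v 1 - q)} := by
      refine convexHull_min ?_ ?_
      · rintro v (rfl | rfl | rfl) <;> simp [hb.le]
      · rintro v ⟨h1, h2, h3⟩ w ⟨h4, h5, h6⟩ α β hα hβ hαβ
        obtain rfl : β = 1 - α := by linarith
        simp only [Set.mem_ofPred_eq, Pi.add_apply, Pi.smul_apply, smul_eq_mul]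
        refine ⟨?_, ?_, ?_⟩ <;> nlinarith
    simpa [upperTriangle] using hsub h
  · rintro ⟨h1, h2, h3⟩
    refine mem_convexHull_of_exists_fintype (ι := Fin 3)
      ![1 - z.2 / b, 1 - z.1 / (2 * b), z.1 / (2 * b) + z.2 / b - 1]
      ![![p + 2 * b, q], ![p, q + b], ![p + 2 * b, q + b]] ?_ ?_ ?_ ?_
    · have h4 : 0 ≤ z.1 / (2 * b) + z.2 / b - 1 := by
        rw [show z.1 / (2 * b) + z.2 / b - 1 = (z.1 / 2 + z.2 - b) / b by field_simp]
        exact div_nonneg (by linarith) hb.le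
      have h5 : 0 ≤ 1 - z.1 / (2 * b) := sub_nonneg.2 (div_le_one_of_le₀ h1 (by positivity))
      have h6 : 0 ≤ 1 - z.2 / b := sub_nonneg.2 (div_le_one_of_le₀ h2 hb.le)
      intro i
      fin_cases i <;> assumption
    · simp only [Fin.sum_univ_three, Matrix.cons_val]
      ring
    · intro i
      fin_cases i <;> simp
    · ext i
      fin_cases i <;> simp [Fin.sum_univ_three] <;> field_simp <;> ring

lemma preimage_prismLower (hd : 2 ≤ n + 2) (a : Fin (n + 2) → ℝ) {b : ℝ} (hb : 0 < b) :
    coordEquiv a ⁻¹' prismLower (n + 2) hd a b = lowerTriangle b ×ˢ fiberBox n b := by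
  ext ⟨z, r⟩
  refine and_congr (mem_convexHull_lowerTriangle hb (a 0) (a 1) z) ?_
  rw [forall_fin_add_two]
  simp [fiberBox, Set.mem_pi, -Set.pi_univ_Icc]

lemma preimage_prismUpper (hd : 2 ≤ n + 2) (a : Fin (n + 2) → ℝ) {b : ℝ} (hb : 0 < b) :
    coordEquiv a ⁻¹' prismUpper (n + 2) hd a b = upperTriangle b ×ˢ fiberBox n b := by
  ext ⟨z, r⟩
  refine and_congr (mem_convexHull_upperTriangle hb (a 0) (a 1) z) ?_
  rw [forall_fin_add_two]
  simp [fiberBox, Set.mem_pi, -Set.pi_univ_Icc]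

lemma meanL2sq_cubes (a : Fin (n + 2) → ℝ) {b : ℝ} (hb : 0 < b) :
    meanL2sq (boxI (n + 2) a b) ![cubeLeft (n + 2) a b, cubeRight (n + 2) a b] =
      1 / (8 * b ^ (n + 2)) *
        ((∫ z in planeBox b, z.1 * z.2) / b ^ (n + 2) * (∫ t in (0)..b, t) ^ n -
          5 / 9 * b ^ 6 / (b ^ (n + 2)) ^ 2 * (b ^ 3 / 3) ^ n) := by
  refine meanL2sq_of_cylinders hb
    (T := ![Set.Icc 0 b ×ˢ Set.Icc 0 b, Set.Icc b (2 * b) ×ˢ Set.Icc 0 b])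
    (f := ![fun z => (z.1 - max (z.1 - b) 0) * z.2, fun z => max (z.1 - b) 0 * z.2])
    ?_ ?_ ?_ ?_ ?_ ?_ ?_ (integral_cube_profile hb.le)
  · exact Fin.forall_fin_two.2 ⟨preimage_cubeLeft a b, preimage_cubeRight a b⟩
  · exact Fin.forall_fin_two.2
      ⟨Set.prod_mono_left (Set.Icc_subset_Icc_right (by linarith)),
        Set.prod_mono_left (Set.Icc_subset_Icc_left hb.le)⟩
  · exact Fin.forall_fin_two.2
      ⟨measurableSet_Icc.prod measurableSet_Icc, measurableSet_Icc.prod measurableSet_Icc⟩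
  · exact Fin.forall_fin_two.2 ⟨by simp; fun_prop, by simp; fun_prop⟩
  · exact Fin.forall_fin_two.2 ⟨fun z hz => volume_real_left_square_inter_Iic hb.le hz,
      fun z hz => volume_real_right_square_inter_Iic hz⟩
  · have h : max (2 * b - b) 0 = b := by rw [max_eq_left (by linarith)]; ring
    refine Fin.forall_fin_two.2 ⟨?_, ?_⟩ <;> simp only [Matrix.cons_val_zero,
      Matrix.cons_val_one, h] <;> ring
  · intro z
    simp only [Matrix.cons_val_zero, Matrix.cons_val_one]
    ring

lemma meanL2sq_prisms (hd : 2 ≤ n + 2) (a : Fin (n + 2) → ℝ) {b : ℝ} (hb : 0 < b) :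
    meanL2sq (boxI (n + 2) a b) ![prismLower (n + 2) hd a b, prismUpper (n + 2) hd a b] =
      1 / (8 * b ^ (n + 2)) *
        ((∫ z in planeBox b, z.1 * z.2) / b ^ (n + 2) * (∫ t in (0)..b, t) ^ n -
          3 / 5 * b ^ 6 / (b ^ (n + 2)) ^ 2 * (b ^ 3 / 3) ^ n) := by
  have hcont := continuous_excess b
  refine meanL2sq_of_cylinders hb
    (T := ![lowerTriangle b, upperTriangle b])
    (f := ![fun z => z.1 * z.2 - excess b z.1 z.2 ^ 2, fun z => excess b z.1 z.2 ^ 2])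
    ?_ ?_ ?_ ?_ ?_ ?_ ?_ (integral_prism_profile hb.le)
  · exact Fin.forall_fin_two.2 ⟨preimage_prismLower hd a hb, preimage_prismUpper hd a hb⟩
  · refine Fin.forall_fin_two.2 ⟨?_, ?_⟩
    · rintro z ⟨h1, h2, h3⟩
      exact ⟨⟨h1, by linarith⟩, h2, by linarith⟩
    · rintro z ⟨h1, h2, h3⟩
      exact ⟨⟨by linarith, h1⟩, by linarith, h2⟩
  · exact Fin.forall_fin_two.2
      ⟨measurableSet_lowerTriangle b, measurableSet_upperTriangle b⟩
  · exact Fin.forall_fin_two.2 ⟨by simp; fun_prop, by simp; fun_prop⟩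
  · exact Fin.forall_fin_two.2 ⟨fun z hz => volume_real_lowerTriangle_inter_Iic hz,
      fun z hz => volume_real_upperTriangle_inter_Iic hz⟩
  · have h : excess b (2 * b) b = b := by rw [excess, max_eq_left (by linarith)]; ring
    refine Fin.forall_fin_two.2 ⟨?_, ?_⟩
    · simp only [Matrix.cons_val_zero, h]
      ring
    · simp only [Matrix.cons_val_one, Matrix.cons_val_zero, h]
  · intro z
    simp only [Matrix.cons_val_zero, Matrix.cons_val_one]
    ring

end Cylinders

/-- Lemma 2: the difference between the mean squared L2-discrepancies of the stratified
samples from the cube partition and from the prism partition of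
`I = [a₁,a₁+2b] × ∏_{i=2}^d [aᵢ,aᵢ+b]` equals `(1/20)·3^{−d} > 0`. -/
theorem cube_sub_prism_meanL2sq (d : ℕ) (hd : 2 ≤ d) (a : Fin d → ℝ) (b : ℝ) (hb : 0 < b) :
    meanL2sq (boxI d a b) ![cubeLeft d a b, cubeRight d a b] -
        meanL2sq (boxI d a b) ![prismLower d hd a b, prismUpper d hd a b] =
      (1 / 20) * ((3 : ℝ) ^ d)⁻¹ ∧
      (0 : ℝ) < (1 / 20) * ((3 : ℝ) ^ d)⁻¹ := by
  refine ⟨?_, by positivity⟩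
  obtain ⟨n, rfl⟩ := Nat.exists_eq_add_of_le' hd
  rw [meanL2sq_cubes a hb, meanL2sq_prisms hd a hb]
  generalize (∫ z in planeBox b, z.1 * z.2) = A, (∫ t in (0)..b, t) = C
  rw [div_pow]
  field_simp
  ring

end StratifiedSampling
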